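/- Let 1/2 < δ < 3/2. There is a constant C = C(δ) such that for every ψ ∈ C_c^∞(ℝ³), setting q = ∫_{ℝ³} ψ(x) dx and letting u(x) = −(1/(4π)) ∫_{ℝ³} ψ(y)/|x−y| dy be the Newtonian potential of ψ (so that Δu = ψ), one has ∫_{ℝ³} |x|^{2δ} |∇( u(x) + q/(4π|x|) )|² dx ≤ C ‖ |x|^δ ψ ‖²_{L^{6/5}(ℝ³)}. -/

import Mathlib

open MeasureTheory Real

noncomputable abbrev E3 := EuclideanSpace ℝ (Fin 3)

/-- The Newtonian potential `u(x) = -(1/(4π)) ∫ ψ(y)/|x-y| dy` of `ψ`, so that `Δu = ψ`. -/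
noncomputable def newtonPotential (ψ : E3 → ℝ) : E3 → ℝ :=
  fun x => -(1 / (4 * π)) * ∫ y, ψ y / ‖x - y‖


open scoped ENNReal

/-- The power weight `|x|^a` as an extended nonnegative real. -/
noncomputable def pw (a : ℝ) (x : E3) : ℝ≥0∞ := ENNReal.ofReal (‖x‖ ^ a)

lemma pw_meas (a : ℝ) : Measurable (pw a) := by
  unfold pw; fun_prop

lemma pw_add {x : E3} (hx : x ≠ 0) (a b : ℝ) : pw (a + b) x = pw a x * pw b x := by
  unfold pw
  rw [Real.rpow_add (norm_pos_iff.mpr hx), ENNReal.ofReal_mul (by positivity)]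

lemma pw_rpow (x : E3) (a p : ℝ) (hp : 0 ≤ p) : pw a x ^ p = pw (a * p) x := by
  unfold pw
  rw [ENNReal.ofReal_rpow_of_nonneg (by positivity) hp, ← Real.rpow_mul (norm_nonneg _)]

lemma pw_ne_top (a : ℝ) (x : E3) : pw a x ≠ ⊤ := ENNReal.ofReal_ne_top

lemma rad_aux (a : ℝ) (T : Set ℝ) (hT : MeasurableSet T)
    (hi : IntegrableOn (fun r : ℝ => r ^ (a + 2)) (T ∩ Set.Ioi 0)) :
    ∫⁻ x in {x : E3 | ‖x‖ ∈ T}, pw a x =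
      ENNReal.ofReal (3 * volume.real (Metric.ball (0 : E3) 1) *
        ∫ r in T ∩ Set.Ioi 0, r ^ (a + 2)) := by
  have hm : MeasurableSet {x : E3 | ‖x‖ ∈ T} := measurable_norm hT
  have hfr : Module.finrank ℝ E3 = 3 := by simp
  have key : ∀ y ∈ Set.Ioi (0:ℝ), y ^ (Module.finrank ℝ E3 - 1) • T.indicator (fun r => r ^ a) y
      = T.indicator (fun r => r ^ (a + 2)) y := by
    intro y hy
    have hy' : 0 < y := hy
    rw [hfr]
    by_cases h : y ∈ T
    · simp only [Set.indicator_of_mem h, smul_eq_mul]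
      rw [Real.rpow_add hy', mul_comm]
      norm_num
    · simp [h]
  have hIntg : Integrable (fun x : E3 => T.indicator (fun r => r ^ a) ‖x‖) := by
    rw [integrable_fun_norm_addHaar volume (f := T.indicator (fun r => r ^ a)),
      integrableOn_congr_fun key measurableSet_Ioi]
    rwa [IntegrableOn, integrable_indicator_iff hT, IntegrableOn, Measure.restrict_restrict hT]
  have hval := integral_fun_norm_addHaar (volume : Measure E3) (T.indicator (fun r => r ^ a))
  rw [setIntegral_congr_fun measurableSet_Ioi key, hfr, setIntegral_indicator hT,
    Set.inter_comm] at hval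
  rw [← lintegral_indicator hm]
  have : ∀ x : E3, {x : E3 | ‖x‖ ∈ T}.indicator (pw a) x
      = ENNReal.ofReal (T.indicator (fun r => r ^ a) ‖x‖) := by
    intro x
    by_cases h : ‖x‖ ∈ T
    · rw [Set.indicator_of_mem h, Set.indicator_of_mem (by exact h)]; rfl
    · rw [Set.indicator_of_notMem h, Set.indicator_of_notMem (by exact h)]; simp
  simp_rw [this]
  rw [← ofReal_integral_eq_lintegral_ofReal hIntg, hval]
  · congr 1
    simp [mul_assoc]
  · filter_upwards with x
    by_cases h : ‖x‖ ∈ T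
    · rw [Set.indicator_of_mem h]; simp; positivity
    · rw [Set.indicator_of_notMem h]; simp

lemma rad_in (a : ℝ) (ha : -3 < a) : ∃ c : ℝ, 0 < c ∧ ∀ R : ℝ, 0 < R →
    ∫⁻ x in {x : E3 | ‖x‖ ≤ R}, pw a x ≤ ENNReal.ofReal (c * R ^ (a + 3)) := by
  refine ⟨3 * volume.real (Metric.ball (0 : E3) 1) / (a + 3), ?_, fun R hR => ?_⟩
  · have : 0 < volume.real (Metric.ball (0 : E3) 1) :=
      ENNReal.toReal_pos (Metric.measure_ball_pos _ _ one_pos).ne' measure_ball_lt_top.ne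
    have : 0 < a + 3 := by linarith
    positivity
  have hs : Set.Iic R ∩ Set.Ioi (0:ℝ) = Set.Ioc 0 R := by ext; simp [and_comm]
  have h := rad_aux a (Set.Iic R) measurableSet_Iic (by
    rw [hs, ← intervalIntegrable_iff_integrableOn_Ioc_of_le hR.le]
    exact intervalIntegral.intervalIntegrable_rpow' (by linarith))
  rw [hs, ← intervalIntegral.integral_of_le hR.le, integral_rpow (Or.inl (by linarith)),
    Real.zero_rpow (by linarith)] at h
  refine le_of_eq (h.trans ?_)
  congr 1
  rw [show a + 2 + 1 = a + 3 by ring]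
  ring

lemma rad_out (a : ℝ) (ha : a < -3) : ∃ c : ℝ, 0 < c ∧ ∀ R : ℝ, 0 < R →
    ∫⁻ x in {x : E3 | R ≤ ‖x‖}, pw a x ≤ ENNReal.ofReal (c * R ^ (a + 3)) := by
  refine ⟨3 * volume.real (Metric.ball (0 : E3) 1) / (-(a + 3)), ?_, fun R hR => ?_⟩
  · have : 0 < volume.real (Metric.ball (0 : E3) 1) :=
      ENNReal.toReal_pos (Metric.measure_ball_pos _ _ one_pos).ne' measure_ball_lt_top.ne
    have : 0 < -(a + 3) := by linarith
    positivity
  have hs : Set.Ici R ∩ Set.Ioi (0:ℝ) = Set.Ici R := by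
    ext x; simp only [Set.mem_inter_iff, Set.mem_Ici, Set.mem_Ioi, and_iff_left_iff_imp]
    intro h; linarith
  have h := rad_aux a (Set.Ici R) measurableSet_Ici (by
    rw [hs, integrableOn_Ici_iff_integrableOn_Ioi]
    exact integrableOn_Ioi_rpow_of_lt (by linarith) hR)
  rw [hs, integral_Ici_eq_integral_Ioi, integral_Ioi_rpow_of_lt (by linarith) hR] at h
  refine le_of_eq (h.trans ?_)
  congr 1
  rw [show a + 2 + 1 = a + 3 by ring, div_neg]
  ring


lemma swapS (S : Set (E3 × E3)) (hS : MeasurableSet S) (f F : E3 → ℝ≥0∞) (hf : Measurable f)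
    (hF : Measurable F) :
    ∫⁻ x, f x * ∫⁻ y in {y | (x, y) ∈ S}, F y = ∫⁻ y, F y * ∫⁻ x in {x | (x, y) ∈ S}, f x := by
  have e1 : ∀ x, f x * ∫⁻ y in {y | (x, y) ∈ S}, F y
      = ∫⁻ y, S.indicator (fun p => f p.1 * F p.2) (x, y) := by
    intro x
    rw [← lintegral_const_mul _ hF, ← lintegral_indicator (show MeasurableSet {y | (x, y) ∈ S} from measurable_prodMk_left hS)]
    rfl
  have e2 : ∀ y, F y * ∫⁻ x in {x | (x, y) ∈ S}, f x
      = ∫⁻ x, S.indicator (fun p => f p.1 * F p.2) (x, y) := by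
    intro y
    rw [← lintegral_const_mul _ hf, ← lintegral_indicator (show MeasurableSet {x | (x, y) ∈ S} from measurable_prodMk_right hS)]
    simp_rw [mul_comm (F y)]
    rfl
  simp_rw [e1, e2]
  apply lintegral_lintegral_swap
  apply Measurable.aemeasurable
  exact (((hf.comp measurable_fst).mul (hF.comp measurable_snd)).indicator hS)

lemma measS (S : Set (E3 × E3)) (hS : MeasurableSet S) (F : E3 → ℝ≥0∞) (hF : Measurable F) :
    Measurable (fun x => ∫⁻ y in {y | (x, y) ∈ S}, F y) := by
  have e1 : ∀ x, ∫⁻ y in {y | (x, y) ∈ S}, F y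
      = ∫⁻ y, S.indicator (fun p => F p.2) (x, y) := by
    intro x
    rw [← lintegral_indicator (show MeasurableSet {y | (x, y) ∈ S} from measurable_prodMk_left hS)]
    rfl
  simp_rw [e1]
  apply Measurable.lintegral_prod_right'
  exact (hF.comp measurable_snd).indicator hS

lemma ae_ne0 : ∀ᵐ x : E3, x ≠ 0 := by
  have := (volume : Measure E3)
  exact Measure.ae_ne volume 0

lemma hardy_gen (α β s : ℝ) (hab : α + β = -2) (S : Set (E3 × E3)) (hS : MeasurableSet S)
    (c1 c2 c3 : ℝ≥0∞)
    (h1 : ∀ x : E3, x ≠ 0 → ∫⁻ y in {y | (x, y) ∈ S}, pw (6 * β - 5 * s) y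
        ≤ c1 * pw (6 * β - 5 * s + 3) x)
    (h2 : ∀ x : E3, x ≠ 0 → ∀ y, (x, y) ∈ S → pw s y ≤ c2 * pw s x)
    (h3 : ∀ y : E3, y ≠ 0 → ∫⁻ x in {x | (x, y) ∈ S}, pw (-3 - s) x ≤ c3 * pw (-s) y)
    (g : E3 → ℝ≥0∞) (hg : Measurable g) :
    ∫⁻ x, (pw α x * ∫⁻ y in {y | (x, y) ∈ S}, pw β y * g y) ^ 2
      ≤ c1 ^ (1 / 3 : ℝ) * c2 ^ (2 / 3 : ℝ) * c3 * (∫⁻ y, g y ^ (6 / 5 : ℝ)) ^ (5 / 3 : ℝ) := by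
  set A := ∫⁻ y, g y ^ (6 / 5 : ℝ) with hA
  have hgm : Measurable (fun y => g y ^ (6 / 5 : ℝ)) := hg.pow_const _
  have hFm : Measurable (fun y => pw s y * g y ^ (6 / 5 : ℝ)) := (pw_meas s).mul hgm
  set B : E3 → ℝ≥0∞ := fun x => ∫⁻ y in {y | (x, y) ∈ S}, pw s y * g y ^ (6 / 5 : ℝ) with hB
  have hsec : ∀ x, MeasurableSet {y | (x, y) ∈ S} := fun x => measurable_prodMk_left hS
  have hBm : Measurable B := measS S hS _ hFm
  have hBA : ∀ x, x ≠ 0 → B x ≤ c2 * pw s x * A := by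
    intro x hx
    calc B x ≤ ∫⁻ y in {y | (x, y) ∈ S}, (c2 * pw s x) * g y ^ (6 / 5 : ℝ) := by
          apply setLIntegral_mono' (hsec x)
          intro y hy
          gcongr
          exact h2 x hx y hy
      _ ≤ ∫⁻ y, (c2 * pw s x) * g y ^ (6 / 5 : ℝ) := setLIntegral_le_lintegral _ _
      _ = _ := lintegral_const_mul _ hgm
  have hI : ∀ x, x ≠ 0 → ∫⁻ y in {y | (x, y) ∈ S}, pw β y * g y
      ≤ B x ^ (5 / 6 : ℝ) * (c1 * pw (6 * β - 5 * s + 3) x) ^ (1 / 6 : ℝ) := by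
    intro x hx
    have hold := ENNReal.lintegral_mul_le_Lp_mul_Lq
      (volume.restrict {y | (x, y) ∈ S}) (p := 6 / 5) (q := 6)
      (by rw [Real.holderConjugate_iff]; norm_num)
      (f := fun y => pw (5 * s / 6) y * g y) (g := fun y => pw (β - 5 * s / 6) y)
      ((pw_meas _).mul hg).aemeasurable (pw_meas _).aemeasurable
    calc ∫⁻ y in {y | (x, y) ∈ S}, pw β y * g y
        = ∫⁻ y in {y | (x, y) ∈ S},
          ((fun y => pw (5 * s / 6) y * g y) * (fun y => pw (β - 5 * s / 6) y)) y := by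
          apply lintegral_congr_ae
          filter_upwards [ae_restrict_of_ae ae_ne0] with y hy
          have : β = 5 * s / 6 + (β - 5 * s / 6) := by ring
          simp only [Pi.mul_apply]
          conv_lhs => rw [this, pw_add hy]
          ring
      _ ≤ _ := hold
      _ ≤ _ := by
          have q1 : ∀ y, (pw (5 * s / 6) y * g y) ^ (6 / 5 : ℝ) = pw s y * g y ^ (6 / 5 : ℝ) := by
            intro y
            rw [ENNReal.mul_rpow_of_nonneg _ _ (by norm_num), pw_rpow _ _ _ (by norm_num)]
            congr 2; ring
          have q2 : ∀ y, (pw (β - 5 * s / 6) y) ^ (6 : ℝ) = pw (6 * β - 5 * s) y := by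
            intro y
            rw [pw_rpow _ _ _ (by norm_num)]
            congr 1; ring
          simp_rw [q1, q2]
          rw [show (1 / (6 / 5) : ℝ) = 5 / 6 by norm_num]
          gcongr
          exact h1 x hx
  have hpt : ∀ x, x ≠ 0 → (pw α x * ∫⁻ y in {y | (x, y) ∈ S}, pw β y * g y) ^ 2
      ≤ (c1 ^ (1 / 3 : ℝ) * c2 ^ (2 / 3 : ℝ) * A ^ (2 / 3 : ℝ)) * (pw (-3 - s) x * B x) := by
    intro x hx
    have r0 : (0 : ℝ) ≤ 2 / 3 := by norm_num
    have r1 : (0 : ℝ) ≤ 1 / 3 := by norm_num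
    calc (pw α x * ∫⁻ y in {y | (x, y) ∈ S}, pw β y * g y) ^ 2
        ≤ (pw α x * (B x ^ (5 / 6 : ℝ) * (c1 * pw (6 * β - 5 * s + 3) x) ^ (1 / 6 : ℝ))) ^ 2 := by
          gcongr; exact hI x hx
      _ = pw (2 * α) x * (B x * B x ^ (2 / 3 : ℝ))
            * (c1 * pw (6 * β - 5 * s + 3) x) ^ (1 / 3 : ℝ) := by
          rw [← ENNReal.rpow_natCast, ENNReal.mul_rpow_of_nonneg _ _ (by norm_num),
            ENNReal.mul_rpow_of_nonneg _ _ (by norm_num), pw_rpow _ _ _ (by norm_num),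
            ← ENNReal.rpow_mul, ← ENNReal.rpow_mul, ← mul_assoc]
          congr 1
          · congr 1
            · congr 1; push_cast; ring
            · nth_rewrite 2 [← ENNReal.rpow_one (B x)]
              rw [← ENNReal.rpow_add_of_nonneg _ _ (by norm_num) (by norm_num)]
              norm_num
          · norm_num
      _ ≤ pw (2 * α) x * (B x * (c2 * pw s x * A) ^ (2 / 3 : ℝ))
            * (c1 * pw (6 * β - 5 * s + 3) x) ^ (1 / 3 : ℝ) := by
          gcongr; exact hBA x hx
      _ = _ := by
          rw [ENNReal.mul_rpow_of_nonneg _ _ r0, ENNReal.mul_rpow_of_nonneg _ _ r0,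
            ENNReal.mul_rpow_of_nonneg _ _ r1, pw_rpow _ _ _ r0, pw_rpow _ _ _ r1]
          have : pw (-3 - s) x = pw (2 * α) x * pw (s * (2 / 3)) x
              * pw ((6 * β - 5 * s + 3) * (1 / 3)) x := by
            rw [← pw_add hx, ← pw_add hx]
            congr 1
            have : α = -2 - β := by linarith
            rw [this]; ring
          rw [this]; ring
  calc ∫⁻ x, (pw α x * ∫⁻ y in {y | (x, y) ∈ S}, pw β y * g y) ^ 2
      ≤ ∫⁻ x, (c1 ^ (1 / 3 : ℝ) * c2 ^ (2 / 3 : ℝ) * A ^ (2 / 3 : ℝ)) * (pw (-3 - s) x * B x) := by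
        apply lintegral_mono_ae
        filter_upwards [ae_ne0] with x hx using hpt x hx
    _ = (c1 ^ (1 / 3 : ℝ) * c2 ^ (2 / 3 : ℝ) * A ^ (2 / 3 : ℝ)) * ∫⁻ x, (pw (-3 - s) x * B x) :=
        lintegral_const_mul _ ((pw_meas _).mul hBm)
    _ ≤ (c1 ^ (1 / 3 : ℝ) * c2 ^ (2 / 3 : ℝ) * A ^ (2 / 3 : ℝ)) * (c3 * A) := by
        gcongr
        simp only [hB]
        rw [swapS S hS _ _ (pw_meas _) hFm, hA, ← lintegral_const_mul _ hgm]
        apply lintegral_mono_ae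
        filter_upwards [ae_ne0] with y hy
        calc pw s y * g y ^ (6 / 5 : ℝ) * ∫⁻ x in {x | (x, y) ∈ S}, pw (-3 - s) x
            ≤ pw s y * g y ^ (6 / 5 : ℝ) * (c3 * pw (-s) y) := by gcongr; exact h3 y hy
          _ = c3 * g y ^ (6 / 5 : ℝ) * pw (s + -s) y := by rw [pw_add hy]; ring
          _ = _ := by simp [pw]
    _ = _ := by
        have : A ^ (5 / 3 : ℝ) = A ^ (2 / 3 : ℝ) * A := by
          nth_rewrite 3 [← ENNReal.rpow_one A]
          rw [← ENNReal.rpow_add_of_nonneg _ _ (by norm_num) (by norm_num)]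
          norm_num
        rw [this]; ring


/-- Indicator-weighted pieces of power weights. -/
noncomputable def pin (R a : ℝ) (w : E3) : ℝ≥0∞ := {w : E3 | ‖w‖ ≤ R}.indicator (pw a) w
noncomputable def pout (R a : ℝ) (w : E3) : ℝ≥0∞ := {w : E3 | R ≤ ‖w‖}.indicator (pw a) w

lemma mset_in (R : ℝ) : MeasurableSet {w : E3 | ‖w‖ ≤ R} := measurable_norm measurableSet_Iic
lemma mset_out (R : ℝ) : MeasurableSet {w : E3 | R ≤ ‖w‖} := measurable_norm measurableSet_Ici

lemma pin_meas (R a : ℝ) : Measurable (pin R a) := (pw_meas a).indicator (mset_in R)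
lemma pout_meas (R a : ℝ) : Measurable (pout R a) := (pw_meas a).indicator (mset_out R)

lemma pin_of {R a : ℝ} {w : E3} (h : ‖w‖ ≤ R) : pin R a w = pw a w :=
  Set.indicator_of_mem (s := {w : E3 | ‖w‖ ≤ R}) h _
lemma pout_of {R a : ℝ} {w : E3} (h : R ≤ ‖w‖) : pout R a w = pw a w :=
  Set.indicator_of_mem (s := {w : E3 | R ≤ ‖w‖}) h _

lemma int_pin (R a : ℝ) (y : E3) :
    ∫⁻ x, pin R a (x - y) = ∫⁻ x in {x : E3 | ‖x‖ ≤ R}, pw a x := by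
  rw [lintegral_sub_right_eq_self (pin R a) y, ← lintegral_indicator (mset_in R)]
  rfl
lemma int_pout (R a : ℝ) (y : E3) :
    ∫⁻ x, pout R a (x - y) = ∫⁻ x in {x : E3 | R ≤ ‖x‖}, pw a x := by
  rw [lintegral_sub_right_eq_self (pout R a) y, ← lintegral_indicator (mset_out R)]
  rfl

lemma comp_pt (v w : E3) (d : ℝ) (hd : 0 < d) (h : d ≤ ‖v‖ + ‖w‖) (hvw : ‖v‖ ≤ ‖w‖) :
    pw (-2) v * pw (-2) w ≤ ENNReal.ofReal (4 * d ^ (-2 : ℝ)) * pin d (-2) v + pout d (-4) v := by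
  have hw : d / 2 ≤ ‖w‖ := by linarith
  rcases eq_or_ne v 0 with rfl | hv
  · have : pw (-2) (0 : E3) = 0 := by simp [pw]
    rw [this, zero_mul]; exact zero_le
  have hv' := norm_pos_iff.mpr hv
  rcases le_total ‖v‖ d with h1 | h1
  · rw [pin_of h1, mul_comm]
    refine le_trans ?_ le_self_add
    gcongr
    unfold pw
    apply ENNReal.ofReal_le_ofReal
    calc ‖w‖ ^ (-2 : ℝ) ≤ (d / 2) ^ (-2 : ℝ) :=
          Real.rpow_le_rpow_of_nonpos (by positivity) hw (by norm_num)
      _ = _ := by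
          rw [Real.div_rpow hd.le (by norm_num)]
          norm_num [Real.rpow_neg]
          ring
  · rw [pout_of h1]
    refine le_trans ?_ le_add_self
    rw [show (-4 : ℝ) = -2 + -2 by norm_num, pw_add hv]
    gcongr
    unfold pw
    apply ENNReal.ofReal_le_ofReal
    exact Real.rpow_le_rpow_of_nonpos hv' hvw (by norm_num)

lemma comp_bd : ∃ c : ℝ, 0 < c ∧ ∀ y z : E3, y ≠ z →
    ∫⁻ x, pw (-2) (x - y) * pw (-2) (x - z) ≤ ENNReal.ofReal c * pw (-1) (y - z) := by
  obtain ⟨c1, hc1, h1⟩ := rad_in (-2) (by norm_num)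
  obtain ⟨c2, hc2, h2⟩ := rad_out (-4) (by norm_num)
  refine ⟨2 * (4 * c1 + c2), by positivity, fun y z hyz => ?_⟩
  set d := ‖y - z‖ with hd
  have hd0 : 0 < d := norm_pos_iff.mpr (sub_ne_zero.mpr hyz)
  set J : E3 → ℝ≥0∞ := fun v => ENNReal.ofReal (4 * d ^ (-2 : ℝ)) * pin d (-2) v + pout d (-4) v
    with hJ
  have hJm : Measurable J := ((pin_meas _ _).const_mul _).add (pout_meas _ _)
  have hJi : ∀ y, ∫⁻ x, J (x - y) ≤ ENNReal.ofReal ((4 * c1 + c2) * d ^ (-1 : ℝ)) := by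
    intro y
    simp only [hJ]
    have m1 : Measurable (fun x => pin d (-2) (x - y)) := (pin_meas _ _).comp (by fun_prop)
    have m2 : Measurable (fun x => pout d (-4) (x - y)) := (pout_meas _ _).comp (by fun_prop)
    rw [lintegral_add_left (m1.const_mul _), lintegral_const_mul _ m1, int_pin, int_pout]
    calc _ ≤ ENNReal.ofReal (4 * d ^ (-2 : ℝ)) * ENNReal.ofReal (c1 * d ^ (-2 + 3 : ℝ))
          + ENNReal.ofReal (c2 * d ^ (-4 + 3 : ℝ)) := by
          gcongr
          · exact h1 d hd0
          · exact h2 d hd0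
      _ = _ := by
          rw [← ENNReal.ofReal_mul (by positivity), ← ENNReal.ofReal_add (by positivity)
            (by positivity)]
          congr 1
          rw [show (-1 : ℝ) = -2 + (-2 + 3) by norm_num, Real.rpow_add hd0 (-2) (-2 + 3)]
          rw [show (-4 + 3 : ℝ) = -2 + (-2 + 3) by norm_num, Real.rpow_add hd0 (-2) (-2 + 3)]
          ring
  have htri : ∀ x, d ≤ ‖x - y‖ + ‖x - z‖ := by
    intro x
    have : y - z = (x - z) - (x - y) := by abel
    rw [hd, this, add_comm]
    exact norm_sub_le _ _
  calc ∫⁻ x, pw (-2) (x - y) * pw (-2) (x - z) ≤ ∫⁻ x, (J (x - y) + J (x - z)) := by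
        apply lintegral_mono
        intro x
        rcases le_total ‖x - y‖ ‖x - z‖ with h | h
        · exact (comp_pt _ _ d hd0 (htri x) h).trans le_self_add
        · simp only
          rw [mul_comm]
          refine (comp_pt _ _ d hd0 ?_ h).trans le_add_self
          rw [add_comm]; exact htri x
    _ = (∫⁻ x, J (x - y)) + ∫⁻ x, J (x - z) :=
        lintegral_add_left (hJm.comp (measurable_id.sub_const y)) _
    _ ≤ ENNReal.ofReal ((4 * c1 + c2) * d ^ (-1 : ℝ))
        + ENNReal.ofReal ((4 * c1 + c2) * d ^ (-1 : ℝ)) := add_le_add (hJi y) (hJi z)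
    _ = _ := by
        unfold pw
        rw [← ENNReal.ofReal_mul (by positivity), ← ENNReal.ofReal_add (by positivity)
            (by positivity)]
        congr 1
        ring

/-- Young-type dichotomy. -/
lemma young_pt (g k l : ℝ) (hg : 0 ≤ g) (hk : 0 ≤ k) (hl : 0 < l) :
    g * k ≤ l * g ^ (6 / 5 : ℝ) + l ^ (-5 : ℝ) * k ^ (6 : ℝ) := by
  rcases le_total k (l * g ^ (1 / 5 : ℝ)) with h | h
  · have : g ^ (6 / 5 : ℝ) = g * g ^ (1 / 5 : ℝ) := by
      nth_rewrite 2 [← Real.rpow_one g]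
      rw [← Real.rpow_add_of_nonneg hg (by norm_num) (by norm_num)]
      norm_num
    have h2 : 0 ≤ l ^ (-5 : ℝ) * k ^ (6 : ℝ) := by positivity
    have h3 : g * k ≤ g * (l * g ^ (1 / 5 : ℝ)) := by gcongr
    rw [this]
    linarith
  · have h1 : 0 ≤ l * g ^ (6 / 5 : ℝ) := by positivity
    have h2 : g ≤ l ^ (-5 : ℝ) * k ^ (5 : ℝ) := by
      have : (l * g ^ (1 / 5 : ℝ)) ^ (5 : ℝ) ≤ k ^ (5 : ℝ) :=
        Real.rpow_le_rpow (by positivity) h (by norm_num)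
      rw [Real.mul_rpow hl.le (by positivity), ← Real.rpow_mul hg] at this
      norm_num at this
      rw [Real.rpow_neg hl.le, ← div_eq_inv_mul, le_div_iff₀ (by positivity)]
      norm_num
      linarith
    have h3 : k ^ (6 : ℝ) = k ^ (5 : ℝ) * k := by norm_num; ring
    rw [h3]
    have : g * k ≤ (l ^ (-5 : ℝ) * k ^ (5 : ℝ)) * k := by gcongr
    linarith

lemma hls_pt : ∃ c : ℝ, 0 < c ∧ ∀ (g : E3 → ℝ), (∀ x, 0 ≤ g x) → Measurable g → ∀ A : ℝ, 0 < A →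
    ∫⁻ z, ENNReal.ofReal (g z ^ (6 / 5 : ℝ)) ≤ ENNReal.ofReal A → ∀ y,
    ∫⁻ z in {z | g z ≤ g y}, ENNReal.ofReal (g z) * pw (-1) (z - y)
      ≤ ENNReal.ofReal (c * A ^ (2 / 3 : ℝ) * g y ^ (1 / 5 : ℝ)) := by
  obtain ⟨c1, hc1, h1⟩ := rad_in (-1) (by norm_num)
  obtain ⟨c2, hc2, h2⟩ := rad_out (-6) (by norm_num)
  refine ⟨c1 + 1 + c2, by positivity, fun g hg hgm A hA hgA y => ?_⟩
  have hset : MeasurableSet {z | g z ≤ g y} := hgm measurableSet_Iic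
  rcases (hg y).eq_or_lt with ht | ht
  · refine le_of_eq_of_le ?_ zero_le
    rw [setLIntegral_congr_fun (g := fun _ => 0) hset]
    · simp
    · intro z hz
      have : g z = 0 := le_antisymm (by rw [ht]; exact hz) (hg z)
      simp [this]
  set t := g y with htdef
  set R := A ^ (1 / 3 : ℝ) * t ^ (-2 / 5 : ℝ) with hR
  set l := A ^ (-1 / 3 : ℝ) * t ^ (1 / 5 : ℝ) with hl
  have hR0 : 0 < R := by positivity
  have hl0 : 0 < l := by positivity
  have hpt : ∀ z, g z ≤ t → ENNReal.ofReal (g z) * pw (-1) (z - y)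
      ≤ (ENNReal.ofReal t * pin R (-1) (z - y) + ENNReal.ofReal l * ENNReal.ofReal (g z ^ (6 / 5 : ℝ)))
        + ENNReal.ofReal (l ^ (-5 : ℝ)) * pout R (-6) (z - y) := by
    intro z hz
    rcases le_total ‖z - y‖ R with h | h
    · rw [pin_of h, add_assoc]
      refine le_trans ?_ le_self_add
      gcongr
    · rw [pout_of h, add_assoc]
      refine le_trans ?_ le_add_self
      unfold pw
      rw [← ENNReal.ofReal_mul (hg z), ← ENNReal.ofReal_mul hl0.le,
        ← ENNReal.ofReal_mul (by positivity), ← ENNReal.ofReal_add (by have := hg z; positivity)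
        (by positivity)]
      apply ENNReal.ofReal_le_ofReal
      have := young_pt (g z) (‖z - y‖ ^ (-1 : ℝ)) l (hg z) (by positivity) hl0
      rw [← Real.rpow_mul (norm_nonneg _)] at this
      norm_num at this ⊢
      exact this
  have m1 : Measurable (fun x => pin R (-1) (x - y)) := (pin_meas _ _).comp (by fun_prop)
  have m2 : Measurable (fun x => pout R (-6) (x - y)) := (pout_meas _ _).comp (by fun_prop)
  have m3 : Measurable (fun z => ENNReal.ofReal (g z ^ (6 / 5 : ℝ))) := by fun_prop
  calc _ ≤ ∫⁻ z in {z | g z ≤ t}, (ENNReal.ofReal t * pin R (-1) (z - y)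
          + ENNReal.ofReal l * ENNReal.ofReal (g z ^ (6 / 5 : ℝ)))
        + ENNReal.ofReal (l ^ (-5 : ℝ)) * pout R (-6) (z - y) :=
        setLIntegral_mono' hset hpt
    _ ≤ ∫⁻ z, (ENNReal.ofReal t * pin R (-1) (z - y)
          + ENNReal.ofReal l * ENNReal.ofReal (g z ^ (6 / 5 : ℝ)))
        + ENNReal.ofReal (l ^ (-5 : ℝ)) * pout R (-6) (z - y) := setLIntegral_le_lintegral _ _
    _ = ENNReal.ofReal t * (∫⁻ x in {x : E3 | ‖x‖ ≤ R}, pw (-1) x)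
          + ENNReal.ofReal l * (∫⁻ z, ENNReal.ofReal (g z ^ (6 / 5 : ℝ)))
        + ENNReal.ofReal (l ^ (-5 : ℝ)) * (∫⁻ x in {x : E3 | R ≤ ‖x‖}, pw (-6) x) := by
        rw [lintegral_add_left (by fun_prop),
          lintegral_add_left (m1.const_mul _), lintegral_const_mul _ m1, lintegral_const_mul _ m2,
          lintegral_const_mul _ m3, int_pin, int_pout]
    _ ≤ ENNReal.ofReal t * ENNReal.ofReal (c1 * R ^ (-1 + 3 : ℝ)) + ENNReal.ofReal l * ENNReal.ofReal A
        + ENNReal.ofReal (l ^ (-5 : ℝ)) * ENNReal.ofReal (c2 * R ^ (-6 + 3 : ℝ)) := by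
        gcongr
        · exact h1 R hR0
        · exact h2 R hR0
    _ = _ := by
        rw [← ENNReal.ofReal_mul ht.le, ← ENNReal.ofReal_mul hl0.le,
          ← ENNReal.ofReal_mul (by positivity), ← ENNReal.ofReal_add (by positivity)
          (by positivity), ← ENNReal.ofReal_add (by positivity) (by positivity)]
        congr 1
        have e1 : t * R ^ (-1 + 3 : ℝ) = A ^ (2 / 3 : ℝ) * t ^ (1 / 5 : ℝ) := by
          rw [hR, Real.mul_rpow (by positivity) (by positivity), ← Real.rpow_mul hA.le,
            ← Real.rpow_mul ht.le]
          nth_rewrite 1 [← Real.rpow_one t]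
          rw [mul_left_comm, ← Real.rpow_add ht]
          norm_num
        have e2 : l * A = A ^ (2 / 3 : ℝ) * t ^ (1 / 5 : ℝ) := by
          rw [hl]
          nth_rewrite 2 [← Real.rpow_one A]
          rw [mul_right_comm, ← Real.rpow_add hA]
          norm_num
        have e3 : l ^ (-5 : ℝ) * R ^ (-6 + 3 : ℝ) = A ^ (2 / 3 : ℝ) * t ^ (1 / 5 : ℝ) := by
          rw [hR, hl, Real.mul_rpow (by positivity) (by positivity),
            Real.mul_rpow (by positivity) (by positivity), ← Real.rpow_mul hA.le,
            ← Real.rpow_mul ht.le, ← Real.rpow_mul hA.le, ← Real.rpow_mul ht.le,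
            mul_mul_mul_comm, ← Real.rpow_add ht, ← Real.rpow_add hA]
          norm_num
        linear_combination c1 * e1 + e2 + c2 * e3

lemma pw_neg_arg (a : ℝ) (x y : E3) : pw a (x - y) = pw a (y - x) := by
  unfold pw; rw [norm_sub_rev]

lemma hls : ∃ c : ℝ, 0 < c ∧ ∀ (g : E3 → ℝ), (∀ x, 0 ≤ g x) → Measurable g → ∀ A : ℝ, 0 < A →
    ∫⁻ z, ENNReal.ofReal (g z ^ (6 / 5 : ℝ)) ≤ ENNReal.ofReal A →
    ∫⁻ x, (∫⁻ y, pw (-2) (x - y) * ENNReal.ofReal (g y)) ^ 2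
      ≤ ENNReal.ofReal (c * A ^ (5 / 3 : ℝ)) := by
  obtain ⟨c1, hc1, h1⟩ := comp_bd
  obtain ⟨c2, hc2, h2⟩ := hls_pt
  refine ⟨2 * c1 * c2, by positivity, fun g hg hgm A hA hgA => ?_⟩
  set G : E3 → ℝ≥0∞ := fun y => ENNReal.ofReal (g y) with hG
  have hGm : Measurable G := by fun_prop
  have pm : ∀ (a : ℝ), Measurable (fun p : E3 × E3 => pw a (p.1 - p.2)) :=
    fun a => (pw_meas a).comp (by fun_prop)
  have pm1 : ∀ (a : ℝ) x, Measurable (fun y : E3 => pw a (x - y)) :=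
    fun a x => (pw_meas a).comp (by fun_prop)
  have pm2 : ∀ (a : ℝ) x, Measurable (fun y : E3 => pw a (y - x)) :=
    fun a x => (pw_meas a).comp (by fun_prop)
  have pmG : ∀ x, Measurable (fun y : E3 => pw (-2) (x - y) * G y) := fun x => (pm1 _ x).mul hGm
  have pmm : ∀ y z, Measurable (fun x : E3 => pw (-2) (x - y) * pw (-2) (x - z)) :=
    fun y z => (pm2 _ y).mul (pm2 _ z)
  have pmG' : ∀ y, Measurable (fun z : E3 => G z * pw (-1) (z - y)) := fun y => hGm.mul (pm2 _ y)
  have step1 : ∫⁻ x, (∫⁻ y, pw (-2) (x - y) * G y) ^ 2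
      = ∫⁻ y, ∫⁻ z, G y * G z * ∫⁻ x, pw (-2) (x - y) * pw (-2) (x - z) := by
    calc ∫⁻ x, (∫⁻ y, pw (-2) (x - y) * G y) ^ 2
        = ∫⁻ x, ∫⁻ y, ∫⁻ z, (pw (-2) (x - y) * G y) * (pw (-2) (x - z) * G z) := by
          apply lintegral_congr
          intro x
          rw [sq, ← lintegral_mul_const _ (pmG x)]
          apply lintegral_congr
          intro y
          rw [← lintegral_const_mul _ (pmG x)]
      _ = ∫⁻ y, ∫⁻ x, ∫⁻ z, (pw (-2) (x - y) * G y) * (pw (-2) (x - z) * G z) := by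
          apply lintegral_lintegral_swap
          apply Measurable.aemeasurable
          apply Measurable.lintegral_prod_right'
            (f := fun q : (E3 × E3) × E3 =>
              (pw (-2) (q.1.1 - q.1.2) * G q.1.2) * (pw (-2) (q.1.1 - q.2) * G q.2))
          have := pw_meas (-2)
          fun_prop
      _ = ∫⁻ y, ∫⁻ z, ∫⁻ x, (pw (-2) (x - y) * G y) * (pw (-2) (x - z) * G z) := by
          apply lintegral_congr
          intro y
          apply lintegral_lintegral_swap
          apply Measurable.aemeasurable
          have := pw_meas (-2)
          unfold Function.uncurry
          fun_prop
      _ = _ := by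
          apply lintegral_congr
          intro y
          apply lintegral_congr
          intro z
          rw [← lintegral_const_mul _ (pmm y z)]
          apply lintegral_congr
          intro x
          ring
  set S : Set (E3 × E3) := {p | g p.2 ≤ g p.1} with hSdef
  have hS : MeasurableSet S := measurableSet_le (by fun_prop) (by fun_prop)
  set S' : Set (E3 × E3) := {p | g p.1 ≤ g p.2} with hSdef'
  have hS' : MeasurableSet S' := measurableSet_le (by fun_prop) (by fun_prop)
  set Φ : E3 × E3 → ℝ≥0∞ := fun p => G p.1 * (G p.2 * pw (-1) (p.2 - p.1)) with hΦ
  have hΦm : Measurable Φ := by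
    have := pw_meas (-1)
    fun_prop
  have hΦs : ∀ y z, Φ (y, z) = Φ (z, y) := by
    intro y z
    simp only [hΦ]
    rw [pw_neg_arg]; ring
  have hhalf : ∫⁻ y, ∫⁻ z, S.indicator Φ (y, z) ≤ ENNReal.ofReal (c2 * A ^ (5 / 3 : ℝ)) := by
    calc ∫⁻ y, ∫⁻ z, S.indicator Φ (y, z)
        = ∫⁻ y, G y * ∫⁻ z in {z | g z ≤ g y}, G z * pw (-1) (z - y) := by
          apply lintegral_congr
          intro y
          rw [← lintegral_const_mul _ (pmG' y), ← lintegral_indicator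
            (show MeasurableSet {z | g z ≤ g y} from hgm measurableSet_Iic)]
          rfl
      _ ≤ ∫⁻ y, G y * ENNReal.ofReal (c2 * A ^ (2 / 3 : ℝ) * g y ^ (1 / 5 : ℝ)) := by
          gcongr with y
          exact h2 g hg hgm A hA hgA y
      _ = ∫⁻ y, ENNReal.ofReal (c2 * A ^ (2 / 3 : ℝ)) * ENNReal.ofReal (g y ^ (6 / 5 : ℝ)) := by
          apply lintegral_congr
          intro y
          simp only [hG]
          rw [← ENNReal.ofReal_mul (hg y), ← ENNReal.ofReal_mul (by positivity)]
          have : g y ^ (6 / 5 : ℝ) = g y * g y ^ (1 / 5 : ℝ) := by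
            nth_rewrite 2 [← Real.rpow_one (g y)]
            rw [← Real.rpow_add_of_nonneg (hg y) (by norm_num) (by norm_num)]
            norm_num
          rw [this]
          congr 1
          ring
      _ = ENNReal.ofReal (c2 * A ^ (2 / 3 : ℝ)) * ∫⁻ y, ENNReal.ofReal (g y ^ (6 / 5 : ℝ)) :=
          lintegral_const_mul _ (by fun_prop)
      _ ≤ ENNReal.ofReal (c2 * A ^ (2 / 3 : ℝ)) * ENNReal.ofReal A := by gcongr
      _ = _ := by
          rw [← ENNReal.ofReal_mul (by positivity), mul_assoc]
          congr 2
          nth_rewrite 2 [← Real.rpow_one A]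
          rw [← Real.rpow_add hA]
          norm_num
  have hhalf' : ∫⁻ y, ∫⁻ z, S'.indicator Φ (y, z) ≤ ENNReal.ofReal (c2 * A ^ (5 / 3 : ℝ)) := by
    rw [lintegral_lintegral_swap (f := fun y z => S'.indicator Φ (y, z))
      (hΦm.indicator hS').aemeasurable]
    refine le_of_eq_of_le ?_ hhalf
    apply lintegral_congr
    intro z
    apply lintegral_congr
    intro y
    by_cases h : g y ≤ g z
    · rw [Set.indicator_of_mem (show (y, z) ∈ S' from h),
        Set.indicator_of_mem (show (z, y) ∈ S from h), hΦs]
    · rw [Set.indicator_of_notMem (show (y, z) ∉ S' from h),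
        Set.indicator_of_notMem (show (z, y) ∉ S from h)]
  rw [step1]
  calc ∫⁻ y, ∫⁻ z, G y * G z * ∫⁻ x, pw (-2) (x - y) * pw (-2) (x - z)
      ≤ ∫⁻ y, ∫⁻ z, ENNReal.ofReal c1 * (S.indicator Φ (y, z) + S'.indicator Φ (y, z)) := by
        apply lintegral_mono
        intro y
        apply lintegral_mono_ae
        filter_upwards [Measure.ae_ne volume y] with z hz
        calc G y * G z * ∫⁻ x, pw (-2) (x - y) * pw (-2) (x - z)
            ≤ G y * G z * (ENNReal.ofReal c1 * pw (-1) (y - z)) := by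
              gcongr; exact h1 y z hz.symm
          _ = ENNReal.ofReal c1 * Φ (y, z) := by
              simp only [hΦ]; rw [pw_neg_arg]; ring
          _ ≤ _ := by
              gcongr
              rcases le_total (g z) (g y) with h | h
              · rw [Set.indicator_of_mem (show (y, z) ∈ S from h)]
                exact le_self_add
              · rw [Set.indicator_of_mem (show (y, z) ∈ S' from h)]
                exact le_add_self
    _ = ENNReal.ofReal c1 * ((∫⁻ y, ∫⁻ z, S.indicator Φ (y, z))
          + ∫⁻ y, ∫⁻ z, S'.indicator Φ (y, z)) := by
        have n1 := hΦm.indicator hS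
        have n2 := hΦm.indicator hS'
        have k1 : Measurable (fun y => ∫⁻ z, S.indicator Φ (y, z)) := n1.lintegral_prod_right'
        have k2 : Measurable (fun y => ∫⁻ z, S'.indicator Φ (y, z)) := n2.lintegral_prod_right'
        rw [← lintegral_add_left k1, ← lintegral_const_mul _ (by fun_prop)]
        apply lintegral_congr
        intro y
        have l1 : Measurable (fun z => S.indicator Φ (y, z)) := n1.comp measurable_prodMk_left
        have l2 : Measurable (fun z => S'.indicator Φ (y, z)) := n2.comp measurable_prodMk_left
        rw [← lintegral_add_left l1, ← lintegral_const_mul _ (by fun_prop)]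
    _ ≤ ENNReal.ofReal c1 * (ENNReal.ofReal (c2 * A ^ (5 / 3 : ℝ))
          + ENNReal.ofReal (c2 * A ^ (5 / 3 : ℝ))) := by gcongr
    _ = _ := by
        rw [← ENNReal.ofReal_add (by positivity) (by positivity), ← ENNReal.ofReal_mul hc1.le]
        congr 1; ring


lemma locint (a : ℝ) (ha : a < 3) : LocallyIntegrable (fun t : E3 => ‖t‖ ^ (-a)) := by
  refine locallyIntegrable_of_norm_le_rpow (C := 1) (α := a) (by simp) (by simpa using ha) ?_ ?_
  · filter_upwards with x
    rw [one_mul, Real.norm_of_nonneg (by positivity)]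
  · exact Measurable.aestronglyMeasurable (by fun_prop)

/-- regularised Newton kernel -/
noncomputable def Nreg (ε : ℝ) (t : E3) : ℝ := (‖t‖ ^ 2 + ε) ^ (-(1 / 2) : ℝ)

lemma Nreg_hasFDerivAt (ε : ℝ) (hε : 0 < ε) (t : E3) :
    HasFDerivAt (Nreg ε) (-((‖t‖ ^ 2 + ε) ^ (-(3 / 2) : ℝ)) • innerSL ℝ t) t := by
  have h := ((hasStrictFDerivAt_norm_sq t).hasFDerivAt.add_const ε).rpow_const
    (p := (-(1 / 2) : ℝ)) (Or.inl (by positivity))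
  unfold Nreg
  convert! h using 1
  rw [show (-(1 / 2) - 1 : ℝ) = -(3 / 2) by norm_num]
  ext v
  simp
  ring

lemma Nreg_le (ε : ℝ) (hε : 0 < ε) (t : E3) (ht : t ≠ 0) (p : ℝ) (hp : 0 ≤ p) :
    (‖t‖ ^ 2 + ε) ^ (-(p / 2) : ℝ) ≤ ‖t‖ ^ (-p) := by
  have ht' := norm_pos_iff.mpr ht
  calc (‖t‖ ^ 2 + ε) ^ (-(p / 2) : ℝ) ≤ (‖t‖ ^ 2) ^ (-(p / 2) : ℝ) :=
        Real.rpow_le_rpow_of_nonpos (by positivity) (by linarith) (by linarith)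
    _ = _ := by
        rw [← Real.rpow_natCast, ← Real.rpow_mul ht'.le]
        congr 1; push_cast; ring

lemma Nreg_tendsto (t : E3) (ht : t ≠ 0) (p : ℝ) :
    Filter.Tendsto (fun n : ℕ => (‖t‖ ^ 2 + 1 / ((n : ℝ) + 1)) ^ (-(p / 2) : ℝ)) Filter.atTop
      (nhds (‖t‖ ^ (-p))) := by
  have ht' := norm_pos_iff.mpr ht
  have e : ‖t‖ ^ (-p) = (‖t‖ ^ 2 + 0) ^ (-(p / 2) : ℝ) := by
    rw [add_zero, ← Real.rpow_natCast, ← Real.rpow_mul ht'.le]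
    congr 1; push_cast; ring
  rw [e]
  apply Filter.Tendsto.rpow_const
  · exact tendsto_const_nhds.add tendsto_one_div_add_atTop_nhds_zero_nat
  · left; positivity

lemma ibp (φ : E3 → ℝ) (hφ : ContDiff ℝ 1 φ) (hc : HasCompactSupport φ) (v : E3) :
    ∫ t, ‖t‖ ^ (-1 : ℝ) * fderiv ℝ φ t v = ∫ t, φ t * (‖t‖ ^ (-3 : ℝ) * inner ℝ t v) := by
  have hcont : Continuous (fun t => fderiv ℝ φ t v) :=
    (hφ.continuous_fderiv (by norm_num)).clm_apply continuous_const
  have hcs : HasCompactSupport (fun t => fderiv ℝ φ t v) := hc.fderiv_apply ℝ v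
  have hNc : ∀ n : ℕ, ∀ p : ℝ, Continuous (fun t : E3 => (‖t‖ ^ 2 + 1 / ((n : ℝ) + 1)) ^ (-(p / 2) : ℝ)) := by
    intro n p
    apply Continuous.rpow_const (by fun_prop)
    intro t; left; positivity
  have hn0 : ∀ n : ℕ, (0 : ℝ) < 1 / ((n : ℝ) + 1) := fun n => by positivity
  have hNN : ∀ n : ℕ, Continuous (Nreg (1 / ((n : ℝ) + 1))) := fun n => hNc n 1
  have hfd : ∀ (n : ℕ) t, fderiv ℝ (Nreg (1 / ((n : ℝ) + 1))) t v
      = -((‖t‖ ^ 2 + 1 / ((n : ℝ) + 1)) ^ (-(3 / 2) : ℝ)) * inner ℝ t v := by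
    intro n t
    rw [(Nreg_hasFDerivAt _ (hn0 n) t).fderiv]
    simp
  have step : ∀ n : ℕ, ∫ t, Nreg (1 / ((n : ℝ) + 1)) t * fderiv ℝ φ t v
      = ∫ t, φ t * ((‖t‖ ^ 2 + 1 / ((n : ℝ) + 1)) ^ (-(3 / 2) : ℝ) * inner ℝ t v) := by
    intro n
    rw [integral_mul_fderiv_eq_neg_fderiv_mul_of_integrable, ← integral_neg]
    · apply integral_congr_ae
      filter_upwards with t
      simp only [hfd]
      ring
    · apply Continuous.integrable_of_hasCompactSupport
      · simp_rw [hfd]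
        have := hNc n 3
        have := hφ.continuous
        fun_prop
      · exact hc.mul_left
    · apply Continuous.integrable_of_hasCompactSupport
      · exact (hNN n).mul hcont
      · exact hcs.mul_left
    · apply Continuous.integrable_of_hasCompactSupport
      · exact (hNN n).mul hφ.continuous
      · exact hc.mul_left
    · intro t _
      exact (Nreg_hasFDerivAt _ (hn0 n) t).differentiableAt
    · intro t _
      exact (hφ.differentiable (by norm_num)) t
  have lim1 : Filter.Tendsto (fun n : ℕ => ∫ t, Nreg (1 / ((n : ℝ) + 1)) t * fderiv ℝ φ t v)
      Filter.atTop (nhds (∫ t, ‖t‖ ^ (-1 : ℝ) * fderiv ℝ φ t v)) := by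
    apply tendsto_integral_of_dominated_convergence
      (fun t => ‖fderiv ℝ φ t v‖ * ‖t‖ ^ (-1 : ℝ))
    · intro n
      exact ((hNN n).mul hcont).aestronglyMeasurable
    · exact (locint 1 (by norm_num)).integrable_smul_left_of_hasCompactSupport hcont.norm hcs.norm
    · intro n
      filter_upwards [ae_ne0] with t ht
      rw [norm_mul, mul_comm]
      gcongr
      rw [Real.norm_of_nonneg (by unfold Nreg; positivity)]
      exact Nreg_le _ (hn0 n) t ht 1 (by norm_num)
    · filter_upwards [ae_ne0] with t ht
      exact (Nreg_tendsto t ht 1).mul_const _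
  have lim2 : Filter.Tendsto (fun n : ℕ => ∫ t, φ t *
        ((‖t‖ ^ 2 + 1 / ((n : ℝ) + 1)) ^ (-(3 / 2) : ℝ) * inner ℝ t v))
      Filter.atTop (nhds (∫ t, φ t * (‖t‖ ^ (-3 : ℝ) * inner ℝ t v))) := by
    apply tendsto_integral_of_dominated_convergence
      (fun t => (‖φ t‖ * ‖v‖) * ‖t‖ ^ (-2 : ℝ))
    · intro n
      have := hNc n 3
      have := hφ.continuous
      exact Continuous.aestronglyMeasurable (by fun_prop)
    · exact (locint 2 (by norm_num)).integrable_smul_left_of_hasCompactSupport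
        (hφ.continuous.norm.mul_const ‖v‖) (hc.norm.mul_right)
    · intro n
      filter_upwards [ae_ne0] with t ht
      have ht' := norm_pos_iff.mpr ht
      rw [norm_mul, norm_mul, mul_assoc]
      refine mul_le_mul_of_nonneg_left ?_ (norm_nonneg _)
      rw [Real.norm_of_nonneg (by positivity)]
      calc _ ≤ ‖t‖ ^ (-3 : ℝ) * (‖t‖ * ‖v‖) := by
            gcongr
            · exact Nreg_le _ (hn0 n) t ht 3 (by norm_num)
            · exact norm_inner_le_norm t v
        _ = _ := by
            rw [show (-2 : ℝ) = -3 + 1 by norm_num, Real.rpow_add ht', Real.rpow_one]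
            ring
    · filter_upwards [ae_ne0] with t ht
      exact ((Nreg_tendsto t ht 3).mul_const _).const_mul _
  simp_rw [step] at lim1
  exact tendsto_nhds_unique lim1 lim2

/-- The corrected kernel. -/
noncomputable def Kker (x y : E3) : E3 := ‖x - y‖ ^ (-3 : ℝ) • (x - y) - ‖x‖ ^ (-3 : ℝ) • x

open scoped Convolution in
lemma pot_hasFDerivAt (ψ : E3 → ℝ) (hψ : ContDiff ℝ 1 ψ) (hc : HasCompactSupport ψ) (x : E3) :
    ∃ D : E3 →L[ℝ] ℝ, HasFDerivAt (fun x => ∫ y, ψ y / ‖x - y‖) D x ∧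
      ∀ v, D v = - ∫ y, ψ y * (‖x - y‖ ^ (-3 : ℝ) * inner ℝ (x - y) v) := by
  have hL := locint 1 (by norm_num)
  have h := hc.hasFDerivAt_convolution_right (ContinuousLinearMap.mul ℝ ℝ) hL hψ x
  have e : ((fun t : E3 => ‖t‖ ^ (-1 : ℝ)) ⋆[ContinuousLinearMap.mul ℝ ℝ, volume] ψ)
      = fun x => ∫ y, ψ y / ‖x - y‖ := by
    ext x
    rw [convolution_def, ← integral_sub_left_eq_self _ volume x]
    apply integral_congr_ae
    filter_upwards with y
    simp [Real.rpow_neg_one, div_eq_mul_inv, mul_comm]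
  rw [e] at h
  refine ⟨_, h, fun v => ?_⟩
  rw [convolution_precompR_apply _ hL (hc.fderiv ℝ) (hψ.continuous_fderiv (by norm_num))]
  have hφ : ContDiff ℝ 1 (fun t => ψ (x - t)) := hψ.comp (contDiff_const.sub contDiff_id)
  have hcφ : HasCompactSupport (fun t => ψ (x - t)) := hc.comp_homeomorph (Homeomorph.subLeft x)
  have hfd : ∀ t, fderiv ℝ (fun t => ψ (x - t)) t v = - fderiv ℝ ψ (x - t) v := by
    intro t
    have h1 : HasFDerivAt (fun t : E3 => x - t) (-ContinuousLinearMap.id ℝ E3) t :=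
      (hasFDerivAt_id t).const_sub x
    have h2 := ((hψ.differentiable (by norm_num)) (x - t)).hasFDerivAt.comp t h1
    have h3 : fderiv ℝ (fun t => ψ (x - t)) t = _ := h2.fderiv
    rw [h3]
    simp
  have := ibp _ hφ hcφ v
  simp_rw [hfd] at this
  rw [convolution_def]
  simp only [ContinuousLinearMap.mul_apply']
  simp only [mul_neg, integral_neg] at this
  rw [← integral_sub_left_eq_self (fun y => ψ y * (‖x - y‖ ^ (-3 : ℝ) * inner ℝ (x - y) v)) volume x]
  simp only [sub_sub_cancel]
  rw [← this, neg_neg]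

lemma ker_integrable (ψ : E3 → ℝ) (hψ : Continuous ψ) (hc : HasCompactSupport ψ) (x v : E3) :
    Integrable (fun y => ψ y * (‖x - y‖ ^ (-3 : ℝ) * inner ℝ (x - y) v)) := by
  have h1 : Integrable (fun t => (‖ψ (x - t)‖ * ‖v‖) * ‖t‖ ^ (-2 : ℝ)) :=
    (locint 2 (by norm_num)).integrable_smul_left_of_hasCompactSupport
      (g := fun t => ‖ψ (x - t)‖ * ‖v‖) (by fun_prop)
      ((hc.comp_homeomorph (Homeomorph.subLeft x)).norm.mul_right)
  have h2 := h1.comp_sub_left x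
  simp only [sub_sub_cancel] at h2
  refine h2.mono' ?_ ?_
  · have := hψ.measurable
    exact Measurable.aestronglyMeasurable (by fun_prop)
  · filter_upwards [Measure.ae_ne volume x] with y hy
    have hy' : 0 < ‖x - y‖ := norm_pos_iff.mpr (sub_ne_zero.mpr hy.symm)
    rw [norm_mul, norm_mul, mul_assoc]
    refine mul_le_mul_of_nonneg_left ?_ (norm_nonneg _)
    rw [Real.norm_of_nonneg (by positivity)]
    calc _ ≤ ‖x - y‖ ^ (-3 : ℝ) * (‖x - y‖ * ‖v‖) := by
          gcongr
          exact norm_inner_le_norm _ v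
      _ = _ := by
          rw [show (-2 : ℝ) = -3 + 1 by norm_num, Real.rpow_add hy', Real.rpow_one]
          ring

lemma coul_hasFDerivAt (q : ℝ) (x : E3) (hx : x ≠ 0) :
    HasFDerivAt (fun y : E3 => q / (4 * π * ‖y‖))
      (-(q / (4 * π) * ‖x‖ ^ (-3 : ℝ)) • innerSL ℝ x) x := by
  have hx' := norm_pos_iff.mpr hx
  have h := ((hasStrictFDerivAt_norm_sq x).hasFDerivAt.rpow_const
    (p := (-(1 / 2) : ℝ)) (Or.inl (by positivity))).const_mul (q / (4 * π))
  have e : (fun y : E3 => q / (4 * π * ‖y‖))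
      = fun y => q / (4 * π) * (‖y‖ ^ 2) ^ (-(1 / 2) : ℝ) := by
    ext y
    rw [← Real.rpow_natCast, ← Real.rpow_mul (norm_nonneg _)]
    norm_num [Real.rpow_neg_one]
    rw [div_mul_eq_div_div, div_eq_mul_inv _ ‖y‖]
  rw [e]
  convert! h using 1
  rw [← Real.rpow_natCast, ← Real.rpow_mul (norm_nonneg _)]
  norm_num
  ext v
  simp
  ring

lemma ker_split (ψ : E3 → ℝ) (hψ : Continuous ψ) (hc : HasCompactSupport ψ) (x v : E3) :
    ∫ y, ψ y * inner ℝ (Kker x y) v = (∫ y, ψ y * (‖x - y‖ ^ (-3 : ℝ) * inner ℝ (x - y) v))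
        - (∫ y, ψ y) * (‖x‖ ^ (-3 : ℝ) * inner ℝ x v) := by
  have hψi : Integrable ψ := hψ.integrable_of_hasCompactSupport hc
  rw [← integral_mul_const, ← integral_sub (ker_integrable ψ hψ hc x v) (hψi.mul_const _)]
  apply integral_congr_ae
  filter_upwards with y
  simp only [Kker, inner_sub_left, real_inner_smul_left]
  ring

lemma grad_val (ψ : E3 → ℝ) (hψ : ContDiff ℝ 1 ψ) (hc : HasCompactSupport ψ) (x : E3)
    (hx : x ≠ 0) (v : E3) :
    fderiv ℝ (fun y : E3 => newtonPotential ψ y + (∫ z, ψ z) / (4 * π * ‖y‖)) x v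
      = 1 / (4 * π) * ∫ y, ψ y * inner ℝ (Kker x y) v := by
  obtain ⟨D, hD, hDv⟩ := pot_hasFDerivAt ψ hψ hc x
  have hF : HasFDerivAt (fun y : E3 => newtonPotential ψ y + (∫ z, ψ z) / (4 * π * ‖y‖)) _ x :=
    (hD.const_mul (-(1 / (4 * π)))).add (coul_hasFDerivAt (∫ z, ψ z) x hx)
  rw [hF.fderiv, ker_split ψ hψ.continuous hc]
  generalize (∫ z, ψ z) = q
  simp only [_root_.add_apply, _root_.smul_apply, hDv, smul_eq_mul,
    innerSL_apply_apply]
  ring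

lemma op_bound (ψ : E3 → ℝ) (hψ : Continuous ψ) (x : E3) (L : E3 →L[ℝ] ℝ)
    (hval : ∀ v, L v = 1 / (4 * π) * ∫ y, ψ y * inner ℝ (Kker x y) v) :
    ‖L‖ₑ ≤ ∫⁻ y, ENNReal.ofReal (|ψ y| * ‖Kker x y‖) := by
  have hKm : Measurable (fun y => Kker x y) := by unfold Kker; fun_prop
  have hψm := hψ.measurable
  by_cases htop : ∫⁻ y, ENNReal.ofReal (|ψ y| * ‖Kker x y‖) = ⊤
  · rw [htop]; exact le_top
  have hn : ∀ y, 0 ≤ |ψ y| * ‖Kker x y‖ := fun y => by positivity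
  have hIntg : Integrable (fun y => |ψ y| * ‖Kker x y‖) := by
    refine ⟨Measurable.aestronglyMeasurable (by fun_prop), ?_⟩
    rw [hasFiniteIntegral_iff_ofReal (Filter.Eventually.of_forall hn)]
    exact lt_top_iff_ne_top.mpr htop
  rw [← ofReal_integral_eq_lintegral_ofReal hIntg (Filter.Eventually.of_forall hn), ← ofReal_norm]
  apply ENNReal.ofReal_le_ofReal
  refine ContinuousLinearMap.opNorm_le_bound _ (integral_nonneg hn) (fun v => ?_)
  rw [hval, norm_mul]
  have hpi : ‖1 / (4 * π)‖ ≤ 1 := by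
    rw [Real.norm_of_nonneg (by positivity), div_le_one (by positivity)]
    linarith [Real.pi_gt_three]
  calc _ ≤ 1 * ‖∫ y, ψ y * inner ℝ (Kker x y) v‖ :=
        mul_le_mul_of_nonneg_right hpi (norm_nonneg _)
    _ ≤ ∫ y, |ψ y| * ‖Kker x y‖ * ‖v‖ := by
        rw [one_mul]
        apply norm_integral_le_of_norm_le (hIntg.mul_const _)
        filter_upwards with y
        rw [norm_mul, Real.norm_eq_abs, mul_assoc]
        exact mul_le_mul_of_nonneg_left (norm_inner_le_norm _ _) (abs_nonneg _)
    _ = _ := integral_mul_const _ _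

lemma grad_bound (ψ : E3 → ℝ) (hψ : ContDiff ℝ 1 ψ) (hc : HasCompactSupport ψ) (x : E3)
    (hx : x ≠ 0) :
    ‖fderiv ℝ (fun y : E3 => newtonPotential ψ y + (∫ z, ψ z) / (4 * π * ‖y‖)) x‖ₑ
      ≤ ∫⁻ y, ENNReal.ofReal (|ψ y| * ‖Kker x y‖) :=
  op_bound ψ hψ.continuous x _ (grad_val ψ hψ hc x hx)

lemma K_far (x y : E3) : ‖Kker x y‖ ≤ ‖x - y‖ ^ (-2 : ℝ) + ‖x‖ ^ (-2 : ℝ) := by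
  have key : ∀ a : E3, ‖‖a‖ ^ (-3 : ℝ) • a‖ ≤ ‖a‖ ^ (-2 : ℝ) := by
    intro a
    rw [norm_smul, Real.norm_of_nonneg (by positivity)]
    rcases eq_or_ne a 0 with rfl | ha
    · simp
    · have ha' := norm_pos_iff.mpr ha
      rw [show (-2 : ℝ) = -3 + 1 by norm_num, Real.rpow_add ha', Real.rpow_one]
  exact (norm_sub_le _ _).trans (add_le_add (key _) (key _))

lemma scal_near (A B Y : ℝ) (hB : 0 < B) (hY : 0 ≤ Y) (h1 : A ≤ B + Y) (h2 : B ≤ A + Y)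
    (h3 : Y ≤ B / 2) :
    (A ^ 3)⁻¹ * Y + |(A ^ 3)⁻¹ - (B ^ 3)⁻¹| * B ≤ 50 * Y * (B ^ 3)⁻¹ := by
  have hA : B / 2 ≤ A := by linarith
  have hA0 : 0 < A := by linarith
  have hi : (A ^ 3)⁻¹ ≤ 8 * (B ^ 3)⁻¹ := by
    have : (B / 2) ^ 3 ≤ A ^ 3 := by gcongr
    calc (A ^ 3)⁻¹ ≤ ((B / 2) ^ 3)⁻¹ := by gcongr
      _ = _ := by field_simp; norm_num
  have hd : |B ^ 3 - A ^ 3| ≤ Y * (5 * B ^ 2) := by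
    have e : B ^ 3 - A ^ 3 = (B - A) * (B ^ 2 + A * B + A ^ 2) := by ring
    rw [e, abs_mul]
    have : |B - A| ≤ Y := abs_le.mpr ⟨by linarith, by linarith⟩
    have h5 : |B ^ 2 + A * B + A ^ 2| ≤ 5 * B ^ 2 := by
      rw [abs_of_nonneg (by positivity)]
      have : A ≤ 3 / 2 * B := by linarith
      nlinarith
    gcongr
  have e2 : (A ^ 3)⁻¹ - (B ^ 3)⁻¹ = (B ^ 3 - A ^ 3) * ((A ^ 3)⁻¹ * (B ^ 3)⁻¹) := by
    field_simp
  have h4 : |(A ^ 3)⁻¹ - (B ^ 3)⁻¹| * B ≤ 40 * Y * (B ^ 3)⁻¹ := by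
    rw [e2, abs_mul, abs_of_nonneg (a := (A ^ 3)⁻¹ * (B ^ 3)⁻¹) (by positivity)]
    calc _ ≤ (Y * (5 * B ^ 2)) * ((8 * (B ^ 3)⁻¹) * (B ^ 3)⁻¹) * B := by gcongr
      _ = _ := by field_simp; ring
  have h6 : (A ^ 3)⁻¹ * Y ≤ 8 * (B ^ 3)⁻¹ * Y := by gcongr
  have h7 : 0 ≤ Y * (B ^ 3)⁻¹ := by positivity
  nlinarith

lemma K_near (x y : E3) (hx : x ≠ 0) (h : ‖y‖ ≤ ‖x‖ / 2) :
    ‖Kker x y‖ ≤ 50 * ‖y‖ * ‖x‖ ^ (-3 : ℝ) := by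
  have hx' := norm_pos_iff.mpr hx
  have r : ∀ t : ℝ, 0 ≤ t → t ^ (-3 : ℝ) = (t ^ 3)⁻¹ := by
    intro t ht
    rw [Real.rpow_neg ht, ← Real.rpow_natCast]
    norm_num
  have e : Kker x y = -(‖x - y‖ ^ (-3 : ℝ) • y) + (‖x - y‖ ^ (-3 : ℝ) - ‖x‖ ^ (-3 : ℝ)) • x := by
    unfold Kker
    rw [smul_sub, sub_smul]
    abel
  have hs := scal_near ‖x - y‖ ‖x‖ ‖y‖ hx' (norm_nonneg _) (norm_sub_le x y)
    (by simpa using norm_add_le (x - y) y) h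
  rw [e]
  refine (norm_add_le _ _).trans ?_
  rw [norm_neg, norm_smul, norm_smul, Real.norm_of_nonneg (by positivity), Real.norm_eq_abs,
    r _ (norm_nonneg _), r _ (norm_nonneg _)]
  exact hs

lemma point_bound (δ : ℝ) (hδ : 0 < δ) (x y : E3) (hx : x ≠ 0) (hy : y ≠ 0) (p : ℝ) (hp : 0 ≤ p) :
    pw δ x * ENNReal.ofReal (p * ‖Kker x y‖) ≤
      50 * (pw (δ - 3) x * Set.indicator {y : E3 | ‖y‖ ≤ ‖x‖}
        (fun y => pw (1 - δ) y * ENNReal.ofReal (‖y‖ ^ δ * p)) y)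
      + ENNReal.ofReal (2 ^ δ) * (pw (-2) (x - y) * ENNReal.ofReal (‖y‖ ^ δ * p))
      + pw (δ - 2) x * Set.indicator {y : E3 | ‖x‖ ≤ 2 * ‖y‖}
        (fun y => pw (-δ) y * ENNReal.ofReal (‖y‖ ^ δ * p)) y := by
  have hx' := norm_pos_iff.mpr hx
  have hy' := norm_pos_iff.mpr hy
  have hc : ‖y‖ ^ (-δ) * ‖y‖ ^ δ = 1 := by
    rw [← Real.rpow_add hy']; simp
  by_cases h : ‖y‖ ≤ ‖x‖ / 2
  · refine le_trans ?_ (le_trans le_self_add le_self_add)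
    rw [Set.indicator_of_mem (by simp only [Set.mem_ofPred_eq]; linarith)]
    simp only [pw]
    rw [show (50 : ℝ≥0∞) = ENNReal.ofReal 50 by norm_num]
    rw [← ENNReal.ofReal_mul (by positivity), ← ENNReal.ofReal_mul (by positivity),
      ← ENNReal.ofReal_mul (by positivity), ← ENNReal.ofReal_mul (by positivity)]
    apply ENNReal.ofReal_le_ofReal
    have hK := K_near x y hx h
    calc ‖x‖ ^ δ * (p * ‖Kker x y‖) ≤ ‖x‖ ^ δ * (p * (50 * ‖y‖ * ‖x‖ ^ (-3 : ℝ))) := by gcongr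
      _ = _ := by
        rw [show δ - 3 = δ + (-3) by ring, Real.rpow_add hx', show 1 - δ = 1 + -δ by ring,
          Real.rpow_add hy', Real.rpow_one]
        linear_combination (-(50 * ‖x‖ ^ δ * p * ‖y‖ * ‖x‖ ^ (-3 : ℝ))) * hc
  · push Not at h
    have h2 : ‖x‖ ≤ 2 * ‖y‖ := by linarith
    rw [add_assoc]
    refine le_trans ?_ le_add_self
    rw [Set.indicator_of_mem (by simpa only [Set.mem_ofPred_eq] using h2)]
    simp only [pw]
    rw [← ENNReal.ofReal_mul (by positivity), ← ENNReal.ofReal_mul (by positivity),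
      ← ENNReal.ofReal_mul (by positivity), ← ENNReal.ofReal_mul (by positivity),
      ← ENNReal.ofReal_mul (by positivity), ← ENNReal.ofReal_add (by positivity) (by positivity)]
    apply ENNReal.ofReal_le_ofReal
    have hK := K_far x y
    have h3 : ‖x‖ ^ δ ≤ 2 ^ δ * ‖y‖ ^ δ := by
      rw [← Real.mul_rpow (by norm_num) (norm_nonneg _)]
      exact Real.rpow_le_rpow (norm_nonneg _) h2 hδ.le
    calc ‖x‖ ^ δ * (p * ‖Kker x y‖)
        ≤ ‖x‖ ^ δ * (p * (‖x - y‖ ^ (-2 : ℝ) + ‖x‖ ^ (-2 : ℝ))) := by gcongr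
      _ = ‖x‖ ^ δ * (p * ‖x - y‖ ^ (-2 : ℝ)) + ‖x‖ ^ δ * (p * ‖x‖ ^ (-2 : ℝ)) := by ring
      _ ≤ (2 ^ δ * ‖y‖ ^ δ) * (p * ‖x - y‖ ^ (-2 : ℝ)) + ‖x‖ ^ δ * (p * ‖x‖ ^ (-2 : ℝ)) := by
          gcongr
      _ = _ := by
        rw [show δ - 2 = δ + (-2) by ring, Real.rpow_add hx']
        linear_combination (-(‖x‖ ^ δ * p * ‖x‖ ^ (-2 : ℝ))) * hc

lemma int_bound (δ : ℝ) (hδ : 0 < δ) (ψ : E3 → ℝ) (hψ : Measurable ψ) (x : E3) (hx : x ≠ 0) :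
    pw δ x * ∫⁻ y, ENNReal.ofReal (|ψ y| * ‖Kker x y‖) ≤
      50 * (pw (δ - 3) x * ∫⁻ y in {y : E3 | ‖y‖ ≤ ‖x‖},
        pw (1 - δ) y * ENNReal.ofReal (‖y‖ ^ δ * |ψ y|))
      + ENNReal.ofReal (2 ^ δ) * (∫⁻ y, pw (-2) (x - y) * ENNReal.ofReal (‖y‖ ^ δ * |ψ y|))
      + pw (δ - 2) x * ∫⁻ y in {y : E3 | ‖x‖ ≤ 2 * ‖y‖},
        pw (-δ) y * ENNReal.ofReal (‖y‖ ^ δ * |ψ y|) := by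
  have hS1 : MeasurableSet {y : E3 | ‖y‖ ≤ ‖x‖} := measurableSet_le (by fun_prop) (by fun_prop)
  have hS3 : MeasurableSet {y : E3 | ‖x‖ ≤ 2 * ‖y‖} := measurableSet_le (by fun_prop) (by fun_prop)
  have hG : Measurable (fun y : E3 => ENNReal.ofReal (‖y‖ ^ δ * |ψ y|)) := by fun_prop
  have m1 : Measurable (fun y => Set.indicator {y : E3 | ‖y‖ ≤ ‖x‖}
        (fun y => pw (1 - δ) y * ENNReal.ofReal (‖y‖ ^ δ * |ψ y|)) y) :=
    ((pw_meas _).mul hG).indicator hS1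
  have m3 : Measurable (fun y => Set.indicator {y : E3 | ‖x‖ ≤ 2 * ‖y‖}
        (fun y => pw (-δ) y * ENNReal.ofReal (‖y‖ ^ δ * |ψ y|)) y) :=
    ((pw_meas _).mul hG).indicator hS3
  have m2 : Measurable (fun y => pw (-2) (x - y) * ENNReal.ofReal (‖y‖ ^ δ * |ψ y|)) :=
    ((pw_meas _).comp (measurable_const.sub measurable_id)).mul hG
  have hK : Measurable (fun y => ENNReal.ofReal (|ψ y| * ‖Kker x y‖)) := by unfold Kker; fun_prop
  rw [← lintegral_indicator hS1, ← lintegral_indicator hS3, ← lintegral_const_mul _ hK,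
    ← lintegral_const_mul _ m1, ← lintegral_const_mul _ (m1.const_mul _),
    ← lintegral_const_mul _ m2, ← lintegral_const_mul _ m3,
    ← lintegral_add_left ((m1.const_mul _).const_mul _),
    ← lintegral_add_right _ (m3.const_mul _)]
  apply lintegral_mono_ae
  filter_upwards [ae_ne0] with y hy
  have := point_bound δ hδ x y hx hy |ψ y| (abs_nonneg _)
  simpa [Set.indicator_apply] using this

lemma hardy1 (δ : ℝ) (hδ : δ < 3 / 2) : ∃ c : ℝ, 0 < c ∧ ∀ g : E3 → ℝ≥0∞, Measurable g →
    ∫⁻ x, (pw (δ - 3) x * ∫⁻ y in {y : E3 | ‖y‖ ≤ ‖x‖}, pw (1 - δ) y * g y) ^ 2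
      ≤ ENNReal.ofReal c * (∫⁻ y, g y ^ (6 / 5 : ℝ)) ^ (5 / 3 : ℝ) := by
  obtain ⟨s, hs⟩ : ∃ s : ℝ, s = (9 - 6 * δ) / 10 := ⟨_, rfl⟩
  have hs0 : 0 < s := by rw [hs]; linarith
  obtain ⟨c1, hc1, H1⟩ := rad_in (6 * (1 - δ) - 5 * s) (by rw [hs]; linarith)
  obtain ⟨c3, hc3, H3⟩ := rad_out (-3 - s) (by linarith)
  refine ⟨c1 ^ (1 / 3 : ℝ) * c3, by positivity, fun g hg => ?_⟩
  have hS : MeasurableSet {z : E3 × E3 | ‖z.2‖ ≤ ‖z.1‖} :=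
    measurableSet_le (by fun_prop) (by fun_prop)
  have := hardy_gen (δ - 3) (1 - δ) s (by ring) {z : E3 × E3 | ‖z.2‖ ≤ ‖z.1‖} hS
    (ENNReal.ofReal c1) 1 (ENNReal.ofReal c3) ?_ ?_ ?_ g hg
  · refine this.trans (le_of_eq ?_)
    rw [ENNReal.one_rpow, mul_one, ENNReal.ofReal_rpow_of_pos hc1,
      ← ENNReal.ofReal_mul (by positivity)]
  · intro x hx
    refine (H1 ‖x‖ (norm_pos_iff.mpr hx)).trans (le_of_eq ?_)
    rw [ENNReal.ofReal_mul hc1.le, pw]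
  · intro x hx y hxy
    rw [one_mul]
    exact ENNReal.ofReal_le_ofReal (Real.rpow_le_rpow (norm_nonneg _) hxy hs0.le)
  · intro y hy
    refine (H3 ‖y‖ (norm_pos_iff.mpr hy)).trans (le_of_eq ?_)
    rw [ENNReal.ofReal_mul hc3.le, pw]
    ring_nf

lemma hardy3 (δ : ℝ) (hδ : 1 / 2 < δ) : ∃ c : ℝ, 0 < c ∧ ∀ g : E3 → ℝ≥0∞, Measurable g →
    ∫⁻ x, (pw (δ - 2) x * ∫⁻ y in {y : E3 | ‖x‖ ≤ 2 * ‖y‖}, pw (-δ) y * g y) ^ 2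
      ≤ ENNReal.ofReal c * (∫⁻ y, g y ^ (6 / 5 : ℝ)) ^ (5 / 3 : ℝ) := by
  obtain ⟨s, hs⟩ : ∃ s : ℝ, s = -((6 * δ - 3) / 10) := ⟨_, rfl⟩
  have hs0 : s < 0 := by rw [hs]; linarith
  obtain ⟨c1, hc1, H1⟩ := rad_out (6 * (-δ) - 5 * s) (by rw [hs]; linarith)
  obtain ⟨c3, hc3, H3⟩ := rad_in (-3 - s) (by linarith)
  obtain ⟨b1, hb1⟩ : ∃ b : ℝ, b = c1 * (1 / 2) ^ (6 * (-δ) - 5 * s + 3) := ⟨_, rfl⟩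
  obtain ⟨b2, hb2⟩ : ∃ b : ℝ, b = (1 / 2 : ℝ) ^ s := ⟨_, rfl⟩
  obtain ⟨b3, hb3⟩ : ∃ b : ℝ, b = c3 * 2 ^ (-s) := ⟨_, rfl⟩
  have p1 : 0 < b1 := by rw [hb1]; positivity
  have p2 : 0 < b2 := by rw [hb2]; positivity
  have p3 : 0 < b3 := by rw [hb3]; positivity
  refine ⟨b1 ^ (1 / 3 : ℝ) * b2 ^ (2 / 3 : ℝ) * b3, by positivity, fun g hg => ?_⟩
  have hS : MeasurableSet {z : E3 × E3 | ‖z.1‖ ≤ 2 * ‖z.2‖} :=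
    measurableSet_le (by fun_prop) (by fun_prop)
  have := hardy_gen (δ - 2) (-δ) s (by ring) {z : E3 × E3 | ‖z.1‖ ≤ 2 * ‖z.2‖} hS
    (ENNReal.ofReal b1) (ENNReal.ofReal b2) (ENNReal.ofReal b3) ?_ ?_ ?_ g hg
  · refine this.trans (le_of_eq ?_)
    rw [ENNReal.ofReal_rpow_of_pos p1, ENNReal.ofReal_rpow_of_pos p2,
      ← ENNReal.ofReal_mul (by positivity), ← ENNReal.ofReal_mul (by positivity)]
  · intro x hx
    have hx' := norm_pos_iff.mpr hx
    have e : {y : E3 | (x, y) ∈ {z : E3 × E3 | ‖z.1‖ ≤ 2 * ‖z.2‖}}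
        = {y : E3 | 1 / 2 * ‖x‖ ≤ ‖y‖} := by
      ext y; simp only [Set.mem_ofPred_eq]; constructor <;> intro h <;> linarith
    rw [e]
    refine (H1 (1 / 2 * ‖x‖) (by positivity)).trans (le_of_eq ?_)
    rw [Real.mul_rpow (by norm_num) hx'.le, ← mul_assoc, ← hb1, ENNReal.ofReal_mul p1.le, pw]
  · intro x hx y hxy
    have hx' := norm_pos_iff.mpr hx
    rw [pw, pw, ← ENNReal.ofReal_mul p2.le, hb2, ← Real.mul_rpow (by norm_num) hx'.le]
    simp only [Set.mem_ofPred_eq] at hxy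
    exact ENNReal.ofReal_le_ofReal
      (Real.rpow_le_rpow_of_nonpos (by positivity) (by linarith) hs0.le)
  · intro y hy
    have hy' := norm_pos_iff.mpr hy
    refine (H3 (2 * ‖y‖) (by positivity)).trans (le_of_eq ?_)
    rw [show -3 - s + 3 = -s by ring, Real.mul_rpow (by norm_num) hy'.le, ← mul_assoc, ← hb3,
      ENNReal.ofReal_mul p3.le, pw]

lemma sq3 (a b c : ℝ≥0∞) : (a + b + c) ^ 2 ≤ 3 * (a ^ 2 + b ^ 2 + c ^ 2) := by
  rcases eq_or_ne a ⊤ with rfl | ha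
  · simp
  rcases eq_or_ne b ⊤ with rfl | hb
  · simp
  rcases eq_or_ne c ⊤ with rfl | hc
  · simp
  lift a to NNReal using ha
  lift b to NNReal using hb
  lift c to NNReal using hc
  norm_cast
  have : ((a : ℝ) + b + c) ^ 2 ≤ 3 * (a ^ 2 + b ^ 2 + c ^ 2) := by
    nlinarith [sq_nonneg ((a : ℝ) - b), sq_nonneg ((a : ℝ) - c), sq_nonneg ((b : ℝ) - c)]
  exact_mod_cast this


lemma main_lint (δ : ℝ) (hδ : 1 / 2 < δ) (hδ' : δ < 3 / 2) : ∃ C : ℝ, 0 < C ∧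
    ∀ ψ : E3 → ℝ, Measurable ψ → ∀ A : ℝ, 0 < A →
      ∫⁻ x : E3, ENNReal.ofReal ((‖x‖ ^ δ * |ψ x|) ^ (6 / 5 : ℝ)) ≤ ENNReal.ofReal A →
      ∫⁻ x : E3, (pw δ x * ∫⁻ y, ENNReal.ofReal (|ψ y| * ‖Kker x y‖)) ^ 2
        ≤ ENNReal.ofReal (C * A ^ (5 / 3 : ℝ)) := by
  obtain ⟨c1, hc1, H1⟩ := hardy1 δ hδ'
  obtain ⟨c3, hc3, H3⟩ := hardy3 δ hδ
  obtain ⟨c2, hc2, H2⟩ := hls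
  refine ⟨3 * (50 ^ 2 * c1 + (2 ^ δ) ^ 2 * c2 + c3), by positivity, fun ψ hψ A hA hle => ?_⟩
  have hg : Measurable (fun y : E3 => ‖y‖ ^ δ * |ψ y|) := by fun_prop
  have hG : Measurable (fun y : E3 => ENNReal.ofReal (‖y‖ ^ δ * |ψ y|)) := by fun_prop
  have hg0 : ∀ y : E3, 0 ≤ ‖y‖ ^ δ * |ψ y| := fun y => by positivity
  have hAle : (∫⁻ y : E3, ENNReal.ofReal (‖y‖ ^ δ * |ψ y|) ^ (6 / 5 : ℝ)) ^ (5 / 3 : ℝ)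
      ≤ ENNReal.ofReal (A ^ (5 / 3 : ℝ)) := by
    rw [← ENNReal.ofReal_rpow_of_pos hA]
    refine ENNReal.rpow_le_rpow (le_trans (le_of_eq ?_) hle) (by norm_num)
    apply lintegral_congr
    intro y
    rw [ENNReal.ofReal_rpow_of_nonneg (hg0 y) (by norm_num)]
  have K1 := (H1 _ hG).trans (mul_le_mul_right hAle _)
  have K3 := (H3 _ hG).trans (mul_le_mul_right hAle _)
  have K2 := H2 _ hg0 hg A hA hle
  have hS1 : MeasurableSet {z : E3 × E3 | ‖z.2‖ ≤ ‖z.1‖} :=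
    measurableSet_le (by fun_prop) (by fun_prop)
  have hS3 : MeasurableSet {z : E3 × E3 | ‖z.1‖ ≤ 2 * ‖z.2‖} :=
    measurableSet_le (by fun_prop) (by fun_prop)
  have M1 : Measurable (fun x : E3 => pw (δ - 3) x * ∫⁻ y in {y : E3 | ‖y‖ ≤ ‖x‖},
        pw (1 - δ) y * ENNReal.ofReal (‖y‖ ^ δ * |ψ y|)) :=
    (pw_meas _).mul (measS _ hS1 _ ((pw_meas _).mul hG))
  have M3 : Measurable (fun x : E3 => pw (δ - 2) x * ∫⁻ y in {y : E3 | ‖x‖ ≤ 2 * ‖y‖},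
        pw (-δ) y * ENNReal.ofReal (‖y‖ ^ δ * |ψ y|)) :=
    (pw_meas _).mul (measS _ hS3 _ ((pw_meas _).mul hG))
  generalize hT1 : (fun x : E3 => pw (δ - 3) x * ∫⁻ y in {y : E3 | ‖y‖ ≤ ‖x‖},
        pw (1 - δ) y * ENNReal.ofReal (‖y‖ ^ δ * |ψ y|)) = T1 at M1
  generalize hT3 : (fun x : E3 => pw (δ - 2) x * ∫⁻ y in {y : E3 | ‖x‖ ≤ 2 * ‖y‖},
        pw (-δ) y * ENNReal.ofReal (‖y‖ ^ δ * |ψ y|)) = T3 at M3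
  obtain ⟨T2, hT2⟩ : ∃ T2 : E3 → ℝ≥0∞, T2 = fun x : E3 =>
    ∫⁻ y, pw (-2) (x - y) * ENNReal.ofReal (‖y‖ ^ δ * |ψ y|) := ⟨_, rfl⟩
  have L1 : ∫⁻ x, T1 x ^ 2 ≤ ENNReal.ofReal c1 * ENNReal.ofReal (A ^ (5 / 3 : ℝ)) := by
    rw [← hT1]; exact K1
  have L3 : ∫⁻ x, T3 x ^ 2 ≤ ENNReal.ofReal c3 * ENNReal.ofReal (A ^ (5 / 3 : ℝ)) := by
    rw [← hT3]; exact K3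
  have L2 : ∫⁻ x, T2 x ^ 2 ≤ ENNReal.ofReal (c2 * A ^ (5 / 3 : ℝ)) := by
    rw [hT2]; exact K2
  have P : ∀ x : E3, x ≠ 0 → pw δ x * ∫⁻ y, ENNReal.ofReal (|ψ y| * ‖Kker x y‖)
      ≤ 50 * T1 x + ENNReal.ofReal (2 ^ δ) * T2 x + T3 x := by
    intro x hx
    rw [← hT1, hT2, ← hT3]
    exact int_bound δ (by linarith) ψ hψ x hx
  calc ∫⁻ x : E3, (pw δ x * ∫⁻ y, ENNReal.ofReal (|ψ y| * ‖Kker x y‖)) ^ 2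
      ≤ ∫⁻ x : E3, 3 * (50 ^ 2 * T1 x ^ 2 + ENNReal.ofReal (2 ^ δ) ^ 2 * T2 x ^ 2 + T3 x ^ 2) := by
        apply lintegral_mono_ae
        filter_upwards [ae_ne0] with x hx
        refine (pow_le_pow_left' (P x hx) 2).trans ((sq3 _ _ _).trans (le_of_eq ?_))
        rw [mul_pow, mul_pow]
    _ = 3 * (50 ^ 2 * (∫⁻ x, T1 x ^ 2) + ENNReal.ofReal (2 ^ δ) ^ 2 * (∫⁻ x, T2 x ^ 2)
          + ∫⁻ x, T3 x ^ 2) := by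
        rw [lintegral_const_mul' _ _ (by norm_num), lintegral_add_right _ (M3.pow_const 2),
          lintegral_add_left ((M1.pow_const 2).const_mul _),
          lintegral_const_mul' _ _ (by norm_num), lintegral_const_mul' _ _ (by finiteness)]
    _ ≤ 3 * (50 ^ 2 * (ENNReal.ofReal c1 * ENNReal.ofReal (A ^ (5 / 3 : ℝ)))
          + ENNReal.ofReal (2 ^ δ) ^ 2 * ENNReal.ofReal (c2 * A ^ (5 / 3 : ℝ))
          + ENNReal.ofReal c3 * ENNReal.ofReal (A ^ (5 / 3 : ℝ))) := by
        gcongr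
    _ = _ := by
        rw [show (3 : ℝ≥0∞) = ENNReal.ofReal 3 by norm_num,
          show (50 : ℝ≥0∞) = ENNReal.ofReal 50 by norm_num,
          ← ENNReal.ofReal_pow (by positivity), ← ENNReal.ofReal_pow (by positivity),
          ← ENNReal.ofReal_mul (by positivity), ← ENNReal.ofReal_mul (by positivity),
          ← ENNReal.ofReal_mul (by positivity), ← ENNReal.ofReal_mul (by positivity),
          ← ENNReal.ofReal_add (by positivity) (by positivity),
          ← ENNReal.ofReal_add (by positivity) (by positivity),
          ← ENNReal.ofReal_mul (by positivity)]
        congr 1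
        ring



/-- **Weighted elliptic estimate for the charge-corrected potential** (Lemma 10.1 of [LS]).
For `1/2 < δ < 3/2` there is `C = C(δ)` such that for every `ψ ∈ C_c^∞(ℝ³)`, with total
charge `q = ∫ ψ` and Newtonian potential `u`,
`∫ |x|^{2δ} |∇(u + q/(4π|x|))|² dx ≤ C ‖ |x|^δ ψ ‖²_{L^{6/5}}`. -/
theorem weighted_potential_estimate (δ : ℝ) (hδ : 1 / 2 < δ) (hδ' : δ < 3 / 2) :
    ∃ C : ℝ, 0 < C ∧
      ∀ ψ : E3 → ℝ, ContDiff ℝ (⊤ : ℕ∞) ψ → HasCompactSupport ψ →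
        (∫ x : E3, ‖x‖ ^ (2 * δ) *
            ‖fderiv ℝ (fun y : E3 =>
                newtonPotential ψ y + (∫ z, ψ z) / (4 * π * ‖y‖)) x‖ ^ 2) ≤
          C * ((∫ x : E3, (‖x‖ ^ δ * |ψ x|) ^ ((6 : ℝ) / 5)) ^ ((5 : ℝ) / 6)) ^ 2 := by
  obtain ⟨C, hC, H⟩ := main_lint δ hδ hδ'
  refine ⟨C, hC, fun ψ hψ hc => ?_⟩
  have hψ1 : ContDiff ℝ 1 ψ := hψ.of_le (by exact_mod_cast le_top)
  have hψc := hψ1.continuous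
  obtain ⟨A0, hA0⟩ : ∃ A0 : ℝ, A0 = ∫ x : E3, (‖x‖ ^ δ * |ψ x|) ^ ((6 : ℝ) / 5) := ⟨_, rfl⟩
  have hg0 : ∀ x : E3, 0 ≤ (‖x‖ ^ δ * |ψ x|) ^ ((6 : ℝ) / 5) := fun x => by positivity
  have hA0n : 0 ≤ A0 := by rw [hA0]; exact integral_nonneg hg0
  have hgc : Continuous (fun x : E3 => (‖x‖ ^ δ * |ψ x|) ^ ((6 : ℝ) / 5)) := by
    refine Continuous.rpow_const ?_ (fun x => Or.inr (by norm_num))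
    exact (continuous_norm.rpow_const (fun x => Or.inr (by linarith))).mul hψc.abs
  have hgs : HasCompactSupport (fun x : E3 => (‖x‖ ^ δ * |ψ x|) ^ ((6 : ℝ) / 5)) := by
    refine hc.mono' (fun x hx => subset_tsupport _ ?_)
    rw [Function.mem_support] at hx ⊢
    intro h0
    apply hx
    rw [h0]
    norm_num
  have hgi := hgc.integrable_of_hasCompactSupport hgs (μ := volume)
  have hlint : ∫⁻ x : E3, ENNReal.ofReal ((‖x‖ ^ δ * |ψ x|) ^ (6 / 5 : ℝ)) = ENNReal.ofReal A0 := by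
    rw [hA0, ofReal_integral_eq_lintegral_ofReal hgi (Filter.Eventually.of_forall hg0)]
  rw [← hA0]
  have hpow : (A0 ^ ((5 : ℝ) / 6)) ^ 2 = A0 ^ (5 / 3 : ℝ) := by
    rw [← Real.rpow_natCast, ← Real.rpow_mul hA0n]
    norm_num
  rw [hpow]
  generalize hI : (∫ x : E3, ‖x‖ ^ (2 * δ) *
            ‖fderiv ℝ (fun y : E3 =>
                newtonPotential ψ y + (∫ z, ψ z) / (4 * π * ‖y‖)) x‖ ^ 2) = I
  have hbd : ∀ A : ℝ, A0 < A → I ≤ C * A ^ (5 / 3 : ℝ) := by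
    intro A hA
    have hA1 : 0 < A := hA0n.trans_lt hA
    have h := H ψ hψc.measurable A hA1 (by rw [hlint]; exact ENNReal.ofReal_le_ofReal hA.le)
    have h2 : ‖I‖ₑ ≤ ENNReal.ofReal (C * A ^ (5 / 3 : ℝ)) := by
      rw [← hI]
      refine (enorm_integral_le_lintegral_enorm _).trans (le_trans (lintegral_mono_ae ?_) h)
      filter_upwards [ae_ne0] with x hx
      have hb := grad_bound ψ hψ1 hc x hx
      calc _ = (pw δ x * ‖fderiv ℝ (fun y : E3 =>
                newtonPotential ψ y + (∫ z, ψ z) / (4 * π * ‖y‖)) x‖ₑ) ^ 2 := by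
            rw [enorm_mul, enorm_pow, enorm_norm, mul_pow]
            congr 1
            rw [Real.enorm_of_nonneg (by positivity), pw, ← ENNReal.ofReal_pow (by positivity),
              ← Real.rpow_natCast, ← Real.rpow_mul (norm_nonneg _), mul_comm 2 δ]
            norm_num
        _ ≤ _ := pow_le_pow_left' (mul_le_mul_right hb _) 2
    rw [← ofReal_norm, ENNReal.ofReal_le_ofReal_iff (by positivity)] at h2
    exact (le_abs_self I).trans h2
  have hcont : Filter.Tendsto (fun A : ℝ => C * A ^ (5 / 3 : ℝ)) (nhdsWithin A0 (Set.Ioi A0))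
      (nhds (C * A0 ^ (5 / 3 : ℝ))) := by
    refine Filter.Tendsto.mono_left ?_ nhdsWithin_le_nhds
    exact ((Real.continuousAt_rpow_const A0 (5 / 3) (Or.inr (by norm_num))).tendsto).const_mul C
  refine ge_of_tendsto hcont ?_
  filter_upwards [self_mem_nhdsWithin] with A hA
  exact hbd A hA
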